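/- Fix p ∈ ℕ, w* ∈ ℝ^p with ‖w*‖ = κ·√p for some κ ≥ 0, δ > 0, a convex L-Lipschitz function ψ : ℝ^p → ℝ, and a measurable link ρ : ℝ → [0,1]; let μ_p be the standard Gaussian measure on ℝ^p, let M_ψ(v, t) = inf_{x ∈ ℝ^p} ( ψ(x) + ‖x − v‖²/(2t) ) be the Moreau envelope, and let c_κ(α,σ) = ∫∫ [ρ(κz₁)·((1 − κ·α·z₁ − σ·z₂)₊)² + (1 − ρ(κz₁))·((1 + κ·α·z₁ − σ·z₂)₊)²] dγ(z₁)dγ(z₂) with γ the standard Gaussian measure on ℝ. Define, for σ > 0, τ > 0, β ≥ 0, α, γ' ∈ ℝ: C(α, σ, γ', β, τ) = (1/p)·∫ M_ψ( (α − σγ'/τ)·w* + (βσ√δ/τ)·h , σ/τ ) dμ_p(h) + β·√(c_κ(α,σ)) − σ·τ/2 − (σ/(2τ))·(δ·β² + γ'²·κ²). Then C is jointly convex in (α, σ) for each fixed (γ', β, τ), and jointly concave in (γ', β, τ) for each fixed (α, σ). -/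

import Mathlib

open MeasureTheory ProbabilityTheory

/-- The summary functional `c_κ(α,σ)` for a general link function `ρ`. -/
noncomputable def summaryFunctional (ρ : ℝ → ℝ) (κ α σ : ℝ) : ℝ :=
  ∫ z₁, ∫ z₂,
    (ρ (κ * z₁) * (max (1 - κ * α * z₁ - σ * z₂) 0) ^ 2
      + (1 - ρ (κ * z₁)) * (max (1 + κ * α * z₁ - σ * z₂) 0) ^ 2)
    ∂(gaussianReal 0 1) ∂(gaussianReal 0 1)

/-- The Moreau envelope `M_ψ(v,t) = inf_x (ψ(x) + ‖x - v‖²/(2t))` on `ℝ^p`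
(Euclidean norm). -/
noncomputable def moreauEnv (p : ℕ) (ψ : (Fin p → ℝ) → ℝ) (v : Fin p → ℝ) (t : ℝ) : ℝ :=
  ⨅ x : Fin p → ℝ, (ψ x + (∑ i, (x i - v i) ^ 2) / (2 * t))

/-- The scalarized CGMT objective for the GMM problem:
`C(α,σ,γ',β,τ) = (1/p)∫ M_ψ((α - σγ'/τ)w* + (βσ√δ/τ)h, σ/τ) dμ_p(h) + β√(c_κ(α,σ))
  - στ/2 - (σ/(2τ))(δβ² + γ'²κ²)`,
where `μ_p` is the standard Gaussian measure on `ℝ^p`. -/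
noncomputable def scalarObjective (p : ℕ) (wstar : Fin p → ℝ) (κ δ : ℝ)
    (ψ : (Fin p → ℝ) → ℝ) (ρ : ℝ → ℝ) (α σ γ' β τ : ℝ) : ℝ :=
  (1 / (p : ℝ)) *
      ∫ h : Fin p → ℝ,
        moreauEnv p ψ
          (fun i => (α - σ * γ' / τ) * wstar i + (β * σ * Real.sqrt δ / τ) * h i)
          (σ / τ)
        ∂(Measure.pi fun _ : Fin p => gaussianReal 0 1)
    + β * Real.sqrt (summaryFunctional ρ κ α σ)
    - σ * τ / 2
    - (σ / (2 * τ)) * (δ * β ^ 2 + γ' ^ 2 * κ ^ 2)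

theorem convexOn_iInf_of_jointly_convex {E X : Type*} [AddCommGroup E] [Module ℝ E]
    [AddCommGroup X] [Module ℝ X] {s : Set E} (hs : Convex ℝ s) {f : E → X → ℝ}
    (hf : ∀ u ∈ s, ∀ v ∈ s, ∀ x y : X, ∀ a b : ℝ, 0 ≤ a → 0 ≤ b → a + b = 1 →
      f (a • u + b • v) (a • x + b • y) ≤ a * f u x + b * f v y)
    (hbdd : ∀ u ∈ s, BddBelow (Set.range (f u))) :
    ConvexOn ℝ s (fun u => ⨅ x, f u x) := by
  refine ⟨hs, fun u hu v hv a b ha hb hab => ?_⟩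
  simp only [smul_eq_mul]
  rw [Real.mul_iInf_of_nonneg ha, Real.mul_iInf_of_nonneg hb]
  exact le_ciInf_add_ciInf fun x y =>
    (ciInf_le (hbdd _ (hs hu hv ha hb hab)) _).trans (hf u hu v hv x y a b ha hb hab)

theorem concaveOn_iInf_of_concaveOn {E X : Type*} [AddCommGroup E] [Module ℝ E] [Nonempty X]
    {s : Set E} (hs : Convex ℝ s) {f : E → X → ℝ}
    (hf : ∀ x, ConcaveOn ℝ s (fun u => f u x))
    (hbdd : ∀ u ∈ s, BddBelow (Set.range (f u))) :
    ConcaveOn ℝ s (fun u => ⨅ x, f u x) := by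
  refine ⟨hs, fun u hu v hv a b ha hb hab => le_ciInf fun x => ?_⟩
  refine le_trans ?_ ((hf x).2 hu hv ha hb hab)
  simp only [smul_eq_mul]
  gcongr
  · exact ciInf_le (hbdd u hu) x
  · exact ciInf_le (hbdd v hv) x

theorem sq_div_combo_le {a b s t : ℝ} (ha : 0 ≤ a) (hb : 0 ≤ b) (hab : a + b = 1)
    (hs : 0 < s) (ht : 0 < t) (x y : ℝ) :
    (a * x + b * y) ^ 2 / (a * s + b * t) ≤ a * (x ^ 2 / s) + b * (y ^ 2 / t) := by
  have hpos : 0 < a * s + b * t := by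
    rcases ha.eq_or_lt with rfl | ha'
    · obtain rfl : b = 1 := by linarith
      simpa using ht
    · positivity
  rw [div_le_iff₀ hpos]
  have key : (a * (x ^ 2 / s) + b * (y ^ 2 / t)) * (a * s + b * t) - (a * x + b * y) ^ 2
      = a * b * (x * t - y * s) ^ 2 / (s * t) := by
    field_simp
    ring
  have : 0 ≤ a * b * (x * t - y * s) ^ 2 / (s * t) := by positivity
  linarith

section SummaryFunctional

theorem memLp_hinge (c d e : ℝ) :
    MemLp (fun z : ℝ × ℝ => max (c + d * z.1 + e * z.2) 0) 2
      ((gaussianReal 0 1).prod (gaussianReal 0 1)) := by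
  have hid : MemLp (fun x : ℝ => x) 2 (gaussianReal 0 1) := memLp_id_gaussianReal 2
  have h1 : MemLp (fun z : ℝ × ℝ => z.1) 2 ((gaussianReal 0 1).prod (gaussianReal 0 1)) :=
    hid.comp_fst _
  have h2 : MemLp (fun z : ℝ × ℝ => z.2) 2 ((gaussianReal 0 1).prod (gaussianReal 0 1)) :=
    hid.comp_snd _
  exact (((memLp_const c).add (h1.const_mul d)).add (h2.const_mul e)).pos_part

theorem integrable_weight_mul_hinge {w : ℝ → ℝ} (hw : Measurable w)
    (hw01 : ∀ t, w t ∈ Set.Icc (0 : ℝ) 1) (κ c d e c' d' e' : ℝ) :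
    Integrable (fun z : ℝ × ℝ => w (κ * z.1) *
        (max (c + d * z.1 + e * z.2) 0 * max (c' + d' * z.1 + e' * z.2) 0))
      ((gaussianReal 0 1).prod (gaussianReal 0 1)) := by
  refine ((memLp_hinge c d e).integrable_mul (memLp_hinge c' d' e')).bdd_mul (c := 1) ?_ ?_
  · exact (by fun_prop : Measurable fun z : ℝ × ℝ => w (κ * z.1)).aestronglyMeasurable
  · refine Filter.Eventually.of_forall fun z => ?_
    rw [Real.norm_eq_abs, abs_le]
    constructor <;> linarith [(hw01 (κ * z.1)).1, (hw01 (κ * z.1)).2]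

/-- The symmetric bilinear form in the two hinge losses underlying `summaryFunctional`. -/
noncomputable def summaryKernel (ρ : ℝ → ℝ) (κ : ℝ) (u v z : ℝ × ℝ) : ℝ :=
  ρ (κ * z.1) * (max (1 + (-κ * u.1) * z.1 + -u.2 * z.2) 0
      * max (1 + (-κ * v.1) * z.1 + -v.2 * z.2) 0)
    + (1 - ρ (κ * z.1)) * (max (1 + (κ * u.1) * z.1 + -u.2 * z.2) 0
      * max (1 + (κ * v.1) * z.1 + -v.2 * z.2) 0)

/-- The polarization of `summaryFunctional`, as an integral over the product measure. -/
noncomputable def summaryPairing (ρ : ℝ → ℝ) (κ : ℝ) (u v : ℝ × ℝ) : ℝ :=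
  ∫ z : ℝ × ℝ, summaryKernel ρ κ u v z ∂((gaussianReal 0 1).prod (gaussianReal 0 1))

variable {ρ : ℝ → ℝ} (hρmeas : Measurable ρ) (hρ : ∀ t, ρ t ∈ Set.Icc (0 : ℝ) 1) (κ : ℝ)
include hρmeas hρ

theorem integrable_summaryKernel (u v : ℝ × ℝ) :
    Integrable (summaryKernel ρ κ u v) ((gaussianReal 0 1).prod (gaussianReal 0 1)) :=
  (integrable_weight_mul_hinge hρmeas hρ κ _ _ _ _ _ _).add
    (integrable_weight_mul_hinge (w := fun t => 1 - ρ t) (measurable_const.sub hρmeas)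
      (fun t => ⟨by linarith [(hρ t).2], by linarith [(hρ t).1]⟩) κ _ _ _ _ _ _)

theorem integrable_summaryKernel_combo (u v : ℝ × ℝ) (r s t : ℝ) :
    Integrable (fun z => r * summaryKernel ρ κ u u z + s * summaryKernel ρ κ u v z
      + t * summaryKernel ρ κ v v z) ((gaussianReal 0 1).prod (gaussianReal 0 1)) :=
  (((integrable_summaryKernel hρmeas hρ κ u u).const_mul r).add
    ((integrable_summaryKernel hρmeas hρ κ u v).const_mul s)).add
    ((integrable_summaryKernel hρmeas hρ κ v v).const_mul t)

theorem summaryPairing_combo (u v : ℝ × ℝ) (r s t : ℝ) :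
    r * summaryPairing ρ κ u u + s * summaryPairing ρ κ u v + t * summaryPairing ρ κ v v
      = ∫ z, (r * summaryKernel ρ κ u u z + s * summaryKernel ρ κ u v z
          + t * summaryKernel ρ κ v v z) ∂((gaussianReal 0 1).prod (gaussianReal 0 1)) := by
  have huu := (integrable_summaryKernel hρmeas hρ κ u u).const_mul r
  have huv := (integrable_summaryKernel hρmeas hρ κ u v).const_mul s
  have hvv := (integrable_summaryKernel hρmeas hρ κ v v).const_mul t
  refine Eq.symm ((integral_add (huu.add huv) hvv).trans ?_)
  rw [integral_add' huu huv]
  simp only [integral_const_mul, summaryPairing]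

theorem summaryFunctional_eq_summaryPairing (u : ℝ × ℝ) :
    summaryFunctional ρ κ u.1 u.2 = summaryPairing ρ κ u u := by
  rw [summaryPairing, integral_prod _ (integrable_summaryKernel hρmeas hρ κ u u),
    summaryFunctional]
  refine integral_congr_ae (Filter.Eventually.of_forall fun z₁ =>
    integral_congr_ae (Filter.Eventually.of_forall fun z₂ => ?_))
  simp only [summaryKernel, ← sq]
  congr 4 <;> ring_nf

theorem summaryPairing_quadratic_nonneg (u v : ℝ × ℝ) (x : ℝ) :
    0 ≤ summaryPairing ρ κ u u * (x * x) + (-2 * summaryPairing ρ κ u v) * x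
      + summaryPairing ρ κ v v := by
  have h := summaryPairing_combo hρmeas hρ κ u v (x * x) (-2 * x) 1
  have h' : 0 ≤ x * x * summaryPairing ρ κ u u + -2 * x * summaryPairing ρ κ u v
      + 1 * summaryPairing ρ κ v v := by
    rw [h]
    refine integral_nonneg fun z => ?_
    have h0 := (hρ (κ * z.1)).1
    have h1 : 0 ≤ 1 - ρ (κ * z.1) := by linarith [(hρ (κ * z.1)).2]
    have := mul_nonneg h0 (sq_nonneg (x * max (1 + (-κ * u.1) * z.1 + -u.2 * z.2) 0
      - max (1 + (-κ * v.1) * z.1 + -v.2 * z.2) 0))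
    have := mul_nonneg h1 (sq_nonneg (x * max (1 + (κ * u.1) * z.1 + -u.2 * z.2) 0
      - max (1 + (κ * v.1) * z.1 + -v.2 * z.2) 0))
    simp only [Pi.zero_apply, summaryKernel]
    linarith
  linarith

omit hρmeas in
theorem summaryPairing_nonneg (u v : ℝ × ℝ) : 0 ≤ summaryPairing ρ κ u v := by
  refine integral_nonneg fun z => ?_
  have h0 := (hρ (κ * z.1)).1
  have h1 : 0 ≤ 1 - ρ (κ * z.1) := by linarith [(hρ (κ * z.1)).2]
  simp only [Pi.zero_apply, summaryKernel]
  positivity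

theorem summaryPairing_le_sqrt_mul_sqrt (u v : ℝ × ℝ) :
    summaryPairing ρ κ u v
      ≤ Real.sqrt (summaryPairing ρ κ u u) * Real.sqrt (summaryPairing ρ κ v v) := by
  have h := discrim_le_zero (summaryPairing_quadratic_nonneg hρmeas hρ κ u v)
  rw [discrim] at h
  rw [← Real.sqrt_mul (summaryPairing_nonneg hρ κ u u)]
  exact Real.le_sqrt_of_sq_le (by linarith)

omit hρmeas hρ in
theorem hinge_combo_le {a b : ℝ} (ha : 0 ≤ a) (hb : 0 ≤ b) {x y z : ℝ}
    (h : z = a * x + b * y) : max z 0 ≤ a * max x 0 + b * max y 0 := by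
  subst h
  refine max_le ?_ (by positivity)
  gcongr <;> exact le_max_left _ _

theorem convexOn_sqrt_summaryFunctional :
    ConvexOn ℝ Set.univ (fun q : ℝ × ℝ => Real.sqrt (summaryFunctional ρ κ q.1 q.2)) := by
  refine ⟨convex_univ, fun u _ v _ a b ha hb hab => ?_⟩
  simp only [summaryFunctional_eq_summaryPairing hρmeas hρ, smul_eq_mul]
  refine Real.sqrt_le_iff.2 ⟨by positivity, ?_⟩
  have hle : summaryPairing ρ κ (a • u + b • v) (a • u + b • v)
      ≤ a ^ 2 * summaryPairing ρ κ u u + 2 * a * b * summaryPairing ρ κ u v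
        + b ^ 2 * summaryPairing ρ κ v v := by
    rw [summaryPairing_combo hρmeas hρ κ u v]
    refine integral_mono (integrable_summaryKernel hρmeas hρ κ _ _)
      (integrable_summaryKernel_combo hρmeas hρ κ u v _ _ _) fun z => ?_
    have h0 := (hρ (κ * z.1)).1
    have h1 : 0 ≤ 1 - ρ (κ * z.1) := by linarith [(hρ (κ * z.1)).2]
    have hsq : ∀ c : ℝ, max (1 + (c * (a • u + b • v).1) * z.1 + -(a • u + b • v).2 * z.2) 0
        * max (1 + (c * (a • u + b • v).1) * z.1 + -(a • u + b • v).2 * z.2) 0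
        ≤ (a * max (1 + (c * u.1) * z.1 + -u.2 * z.2) 0
          + b * max (1 + (c * v.1) * z.1 + -v.2 * z.2) 0)
        * (a * max (1 + (c * u.1) * z.1 + -u.2 * z.2) 0
          + b * max (1 + (c * v.1) * z.1 + -v.2 * z.2) 0) := by
      intro c
      have := hinge_combo_le ha hb
        (x := 1 + (c * u.1) * z.1 + -u.2 * z.2) (y := 1 + (c * v.1) * z.1 + -v.2 * z.2)
        (z := 1 + (c * (a • u + b • v).1) * z.1 + -(a • u + b • v).2 * z.2) (by
          obtain rfl : b = 1 - a := by linarith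
          simp
          ring)
      exact mul_self_le_mul_self (le_max_right _ _) this
    have hneg := mul_le_mul_of_nonneg_left (hsq (-κ)) h0
    have hpos := mul_le_mul_of_nonneg_left (hsq κ) h1
    simp only [summaryKernel]
    linarith
  have hcs := mul_le_mul_of_nonneg_left (summaryPairing_le_sqrt_mul_sqrt hρmeas hρ κ u v)
    (by positivity : 0 ≤ 2 * a * b)
  have hu := Real.sq_sqrt (summaryPairing_nonneg hρ κ u u)
  have hv := Real.sq_sqrt (summaryPairing_nonneg hρ κ v v)
  calc _ ≤ _ := hle
    _ ≤ a ^ 2 * Real.sqrt (summaryPairing ρ κ u u) ^ 2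
        + 2 * a * b * (Real.sqrt (summaryPairing ρ κ u u) * Real.sqrt (summaryPairing ρ κ v v))
        + b ^ 2 * Real.sqrt (summaryPairing ρ κ v v) ^ 2 := by rw [hu, hv]; linarith
    _ = _ := by ring

end SummaryFunctional

section MoreauEnvelope

theorem integrable_gaussian_coord {p : ℕ} (i : Fin p) :
    Integrable (fun h : Fin p → ℝ => h i) (Measure.pi fun _ : Fin p => gaussianReal 0 1) :=
  integrable_comp_eval (μ := fun _ : Fin p => gaussianReal 0 1) (f := fun x : ℝ => x)
    ((memLp_id_gaussianReal 1).integrable (by simp))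

variable {p : ℕ} {ψ : (Fin p → ℝ) → ℝ} {L : ℝ}
  (hL : ∀ u w : Fin p → ℝ, |ψ u - ψ w| ≤ L * Real.sqrt (∑ i, (u i - w i) ^ 2))
include hL

theorem sub_le_moreau_objective (v x : Fin p → ℝ) {t : ℝ} (ht : 0 < t) :
    ψ v - L ^ 2 * t / 2 ≤ ψ x + (∑ i, (x i - v i) ^ 2) / (2 * t) := by
  set r := Real.sqrt (∑ i, (x i - v i) ^ 2) with hr
  have hr2 : ∑ i, (x i - v i) ^ 2 = r ^ 2 :=
    (Real.sq_sqrt (Finset.sum_nonneg fun i _ => sq_nonneg _)).symm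
  have h := (abs_le.1 (hL x v)).1
  rw [← hr] at h
  have key : r ^ 2 / (2 * t) - L * r + L ^ 2 * t / 2 = (r - L * t) ^ 2 / (2 * t) := by
    field_simp
    ring
  have : 0 ≤ (r - L * t) ^ 2 / (2 * t) := by positivity
  rw [hr2]
  linarith

theorem bddBelow_moreau_objective (v : Fin p → ℝ) {t : ℝ} (ht : 0 < t) :
    BddBelow (Set.range fun x : Fin p → ℝ => ψ x + (∑ i, (x i - v i) ^ 2) / (2 * t)) :=
  ⟨ψ v - L ^ 2 * t / 2, by rintro _ ⟨x, rfl⟩; exact sub_le_moreau_objective hL v x ht⟩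

theorem moreauEnv_le (v : Fin p → ℝ) {t : ℝ} (ht : 0 < t) : moreauEnv p ψ v t ≤ ψ v := by
  simpa [moreauEnv] using ciInf_le (bddBelow_moreau_objective hL v ht) v

theorem sub_le_moreauEnv (v : Fin p → ℝ) {t : ℝ} (ht : 0 < t) :
    ψ v - L ^ 2 * t / 2 ≤ moreauEnv p ψ v t :=
  le_ciInf fun x => sub_le_moreau_objective hL v x ht

theorem measurable_moreauEnv {t : ℝ} (ht : 0 < t) :
    Measurable fun v : Fin p → ℝ => moreauEnv p ψ v t :=
  (upperSemicontinuous_ciInf (fun v => bddBelow_moreau_objective hL v ht) fun x =>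
    (by fun_prop : Continuous fun v : Fin p → ℝ =>
      ψ x + (∑ i, (x i - v i) ^ 2) / (2 * t)).upperSemicontinuous).measurable

theorem abs_moreauEnv_le (v : Fin p → ℝ) {t : ℝ} (ht : 0 < t) :
    |moreauEnv p ψ v t| ≤ |ψ 0| + |L| * ∑ i, |v i| + L ^ 2 * t / 2 := by
  have h1 := moreauEnv_le hL v ht
  have h2 := sub_le_moreauEnv hL v ht
  have h3 : |ψ v - ψ 0| ≤ |L| * ∑ i, |v i| := by
    refine (hL v 0).trans ?_
    refine mul_le_mul (le_abs_self L) ?_ (Real.sqrt_nonneg _) (abs_nonneg L)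
    refine Real.sqrt_le_iff.2 ⟨Finset.sum_nonneg fun i _ => abs_nonneg _, ?_⟩
    refine le_trans (le_of_eq ?_)
      (Finset.sum_sq_le_sq_sum_of_nonneg (s := Finset.univ) (f := fun i => |v i|)
        fun i _ => abs_nonneg _)
    simp
  have h4 := abs_le.1 h3
  have h5 : 0 ≤ L ^ 2 * t / 2 := by positivity
  rw [abs_le]
  constructor <;> linarith [neg_abs_le (ψ 0), le_abs_self (ψ 0)]

theorem integrable_moreauEnv_affine (c : Fin p → ℝ) (d : ℝ) {t : ℝ} (ht : 0 < t) :
    Integrable (fun h : Fin p → ℝ => moreauEnv p ψ (fun i => c i + d * h i) t)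
      (Measure.pi fun _ : Fin p => gaussianReal 0 1) := by
  have hb : Integrable (fun h : Fin p → ℝ =>
      |ψ 0| + |L| * ∑ i, |c i + d * h i| + L ^ 2 * t / 2)
      (Measure.pi fun _ : Fin p => gaussianReal 0 1) := by
    refine ((integrable_const _).add (Integrable.const_mul ?_ _)).add (integrable_const _)
    refine integrable_finsetSum _ fun i _ => ?_
    exact ((integrable_const _).add ((integrable_gaussian_coord i).const_mul d)).abs
  refine hb.mono' ?_ (Filter.Eventually.of_forall fun h => ?_)
  · exact ((measurable_moreauEnv hL ht).comp
      (by fun_prop : Measurable fun (h : Fin p → ℝ) i => c i + d * h i)).aestronglyMeasurable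
  · exact abs_moreauEnv_le hL _ ht

end MoreauEnvelope

section TiltedEnvelope

/-- The function minimized in `tiltedEnv`. -/
noncomputable def tiltedObjective {p : ℕ} (w : Fin p → ℝ) (ψ : (Fin p → ℝ) → ℝ)
    (d α σ γ β τ : ℝ) (h x : Fin p → ℝ) : ℝ :=
  ψ x + τ / 2 * ∑ i, (x i - α * w i) ^ 2 / σ
    - ∑ i, (β * d * h i - γ * w i) * (x i - α * w i)

/-- The Moreau envelope in the scalarized objective, after completing the square so that the
quadratic term in `(γ, β)` is removed. -/
noncomputable def tiltedEnv {p : ℕ} (w : Fin p → ℝ) (ψ : (Fin p → ℝ) → ℝ)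
    (d α σ γ β τ : ℝ) (h : Fin p → ℝ) : ℝ :=
  ⨅ x, tiltedObjective w ψ d α σ γ β τ h x

theorem moreau_objective_eq_tiltedObjective_add {p : ℕ} (w : Fin p → ℝ)
    (ψ : (Fin p → ℝ) → ℝ) (d α γ β : ℝ) {σ τ : ℝ} (hσ : 0 < σ) (hτ : 0 < τ)
    (h x : Fin p → ℝ) :
    ψ x + (∑ i, (x i - ((α - σ * γ / τ) * w i + (β * σ * d / τ) * h i)) ^ 2) / (2 * (σ / τ))
      = tiltedObjective w ψ d α σ γ β τ h x
        + σ / (2 * τ) * ∑ i, (β * d * h i - γ * w i) ^ 2 := by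
  rw [tiltedObjective, Finset.sum_div, Finset.mul_sum, Finset.mul_sum, add_sub_assoc,
    add_assoc, ← Finset.sum_sub_distrib, ← Finset.sum_add_distrib]
  congr 1
  refine Finset.sum_congr rfl fun i _ => ?_
  field_simp
  ring

variable {p : ℕ} {ψ : (Fin p → ℝ) → ℝ} {L : ℝ}
  (hL : ∀ u w : Fin p → ℝ, |ψ u - ψ w| ≤ L * Real.sqrt (∑ i, (u i - w i) ^ 2))
  (w : Fin p → ℝ) (d : ℝ)

include hL in
theorem bddBelow_tiltedObjective (α γ β : ℝ) {σ τ : ℝ} (hσ : 0 < σ) (hτ : 0 < τ)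
    (h : Fin p → ℝ) : BddBelow (Set.range (tiltedObjective w ψ d α σ γ β τ h)) := by
  obtain ⟨m, hm⟩ := bddBelow_moreau_objective hL
    (fun i => (α - σ * γ / τ) * w i + (β * σ * d / τ) * h i) (div_pos hσ hτ)
  refine ⟨m - σ / (2 * τ) * ∑ i, (β * d * h i - γ * w i) ^ 2, ?_⟩
  rintro _ ⟨x, rfl⟩
  have := hm ⟨x, rfl⟩
  simp only [moreau_objective_eq_tiltedObjective_add w ψ d α γ β hσ hτ h x] at this
  linarith

include hL in
theorem moreauEnv_eq_tiltedEnv_add (α γ β : ℝ) {σ τ : ℝ} (hσ : 0 < σ) (hτ : 0 < τ)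
    (h : Fin p → ℝ) :
    moreauEnv p ψ (fun i => (α - σ * γ / τ) * w i + (β * σ * d / τ) * h i) (σ / τ)
      = tiltedEnv w ψ d α σ γ β τ h
        + σ / (2 * τ) * ∑ i, (β * d * h i - γ * w i) ^ 2 := by
  rw [tiltedEnv, ciInf_add (bddBelow_tiltedObjective hL w d α γ β hσ hτ h)]
  exact iInf_congr fun x => moreau_objective_eq_tiltedObjective_add w ψ d α γ β hσ hτ h x

theorem integrable_sq_gaussian_affine (b c : ℝ) :
    Integrable (fun x : ℝ => (b * x - c) ^ 2) (gaussianReal 0 1) :=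
  MemLp.integrable_sq
    ((((memLp_id_gaussianReal 2 : MemLp (fun x : ℝ => x) 2 (gaussianReal 0 1)).const_mul b)).sub
      (memLp_const c))

theorem integral_sq_gaussian_affine (b c : ℝ) :
    ∫ x, (b * x - c) ^ 2 ∂(gaussianReal 0 1) = b ^ 2 + c ^ 2 := by
  have hid : MemLp (fun x : ℝ => x) 2 (gaussianReal 0 1) := memLp_id_gaussianReal 2
  have h1 : Integrable (fun x : ℝ => x) (gaussianReal 0 1) := hid.integrable (by simp)
  have h2 : Integrable (fun x : ℝ => x ^ 2) (gaussianReal 0 1) := hid.integrable_sq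
  have hm : ∫ x, x ^ 2 ∂(gaussianReal 0 1) = 1 := by
    have hv := variance_eq_sub hid
    rw [variance_fun_id_gaussianReal] at hv
    simpa [integral_id_gaussianReal] using hv.symm
  have he : ∀ x : ℝ, (b * x - c) ^ 2 = b ^ 2 * x ^ 2 + ((-2 * b * c) * x + c ^ 2) :=
    fun x => by ring
  simp only [he]
  refine (integral_add (h2.const_mul _) ((h1.const_mul _).add (integrable_const _))).trans ?_
  rw [integral_add' (h1.const_mul _) (integrable_const _), integral_const_mul,
    integral_const_mul, hm, integral_id_gaussianReal]
  simp

theorem integrable_sum_sq_gaussian (b : ℝ) (c : Fin p → ℝ) :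
    Integrable (fun h : Fin p → ℝ => ∑ i, (b * h i - c i) ^ 2)
      (Measure.pi fun _ : Fin p => gaussianReal 0 1) :=
  integrable_finsetSum _ fun i _ =>
    integrable_comp_eval (μ := fun _ : Fin p => gaussianReal 0 1)
      (integrable_sq_gaussian_affine b (c i))

theorem integral_sum_sq_gaussian (b : ℝ) (c : Fin p → ℝ) :
    ∫ h : Fin p → ℝ, ∑ i, (b * h i - c i) ^ 2 ∂(Measure.pi fun _ : Fin p => gaussianReal 0 1)
      = p * b ^ 2 + ∑ i, c i ^ 2 := by
  rw [integral_finsetSum _ fun i _ =>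
    integrable_comp_eval (μ := fun _ : Fin p => gaussianReal 0 1)
      (integrable_sq_gaussian_affine b (c i))]
  have h : ∀ i, ∫ h : Fin p → ℝ, (b * h i - c i) ^ 2
      ∂(Measure.pi fun _ : Fin p => gaussianReal 0 1) = b ^ 2 + c i ^ 2 := fun i => by
    rw [← integral_sq_gaussian_affine]
    exact integral_comp_eval (μ := fun _ : Fin p => gaussianReal 0 1)
      (integrable_sq_gaussian_affine b (c i)).aestronglyMeasurable
  simp [h, Finset.sum_add_distrib]

include hL in
theorem tiltedEnv_eq_moreauEnv_sub (α γ β : ℝ) {σ τ : ℝ} (hσ : 0 < σ) (hτ : 0 < τ) :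
    tiltedEnv w ψ d α σ γ β τ = fun h =>
      moreauEnv p ψ (fun i => (α - σ * γ / τ) * w i + (β * σ * d / τ) * h i) (σ / τ)
        - σ / (2 * τ) * ∑ i, (β * d * h i - γ * w i) ^ 2 := by
  funext h
  rw [moreauEnv_eq_tiltedEnv_add hL w d α γ β hσ hτ h, add_sub_cancel_right]

include hL in
theorem integrable_tiltedEnv (α γ β : ℝ) {σ τ : ℝ} (hσ : 0 < σ) (hτ : 0 < τ) :
    Integrable (tiltedEnv w ψ d α σ γ β τ) (Measure.pi fun _ : Fin p => gaussianReal 0 1) := by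
  rw [tiltedEnv_eq_moreauEnv_sub hL w d α γ β hσ hτ]
  exact (integrable_moreauEnv_affine hL _ _ (div_pos hσ hτ)).sub
    ((integrable_sum_sq_gaussian _ _).const_mul _)

include hL in
theorem integral_moreauEnv_eq (α γ β : ℝ) {σ τ : ℝ} (hσ : 0 < σ) (hτ : 0 < τ) :
    ∫ h : Fin p → ℝ,
        moreauEnv p ψ (fun i => (α - σ * γ / τ) * w i + (β * σ * d / τ) * h i) (σ / τ)
        ∂(Measure.pi fun _ : Fin p => gaussianReal 0 1)
      = ∫ h, tiltedEnv w ψ d α σ γ β τ h ∂(Measure.pi fun _ : Fin p => gaussianReal 0 1)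
        + σ / (2 * τ) * (p * (β * d) ^ 2 + γ ^ 2 * ∑ i, w i ^ 2) := by
  simp only [moreauEnv_eq_tiltedEnv_add hL w d α γ β hσ hτ]
  rw [integral_add (integrable_tiltedEnv hL w d α γ β hσ hτ)
    ((integrable_sum_sq_gaussian _ _).const_mul _), integral_const_mul,
    integral_sum_sq_gaussian]
  simp only [mul_pow, Finset.mul_sum]

include hL in
theorem concaveOn_tiltedEnv (α : ℝ) {σ : ℝ} (hσ : 0 < σ) (h : Fin p → ℝ) :
    ConcaveOn ℝ (Set.univ ×ˢ (Set.Ici (0 : ℝ)) ×ˢ (Set.Ioi (0 : ℝ)))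
      (fun q : ℝ × ℝ × ℝ => tiltedEnv w ψ d α σ q.1 q.2.1 q.2.2 h) := by
  have hs : Convex ℝ ((Set.univ : Set ℝ) ×ˢ (Set.Ici (0 : ℝ)) ×ˢ (Set.Ioi (0 : ℝ))) :=
    convex_univ.prod ((convex_Ici 0).prod (convex_Ioi 0))
  refine concaveOn_iInf_of_concaveOn hs (fun x => ⟨hs, fun u _ v _ a b _ _ hab => ?_⟩)
    fun q hq => bddBelow_tiltedObjective hL w d α q.1 q.2.1 hσ hq.2.2 h
  refine le_of_eq ?_
  have hlin : ∑ i, ((a * u.2.1 + b * v.2.1) * d * h i - (a * u.1 + b * v.1) * w i)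
        * (x i - α * w i)
      = a * ∑ i, (u.2.1 * d * h i - u.1 * w i) * (x i - α * w i)
        + b * ∑ i, (v.2.1 * d * h i - v.1 * w i) * (x i - α * w i) := by
    rw [Finset.mul_sum, Finset.mul_sum, ← Finset.sum_add_distrib]
    exact Finset.sum_congr rfl fun i _ => by ring
  simp only [tiltedObjective, Prod.fst_add, Prod.snd_add, Prod.smul_fst, Prod.smul_snd,
    smul_eq_mul, hlin]
  obtain rfl : b = 1 - a := by linarith
  ring

include hL in
theorem convexOn_tiltedEnv (hψ : ConvexOn ℝ Set.univ ψ) (γ β : ℝ) {τ : ℝ} (hτ : 0 < τ)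
    (h : Fin p → ℝ) :
    ConvexOn ℝ (Set.univ ×ˢ Set.Ioi (0 : ℝ))
      (fun q : ℝ × ℝ => tiltedEnv w ψ d q.1 q.2 γ β τ h) := by
  have hs : Convex ℝ ((Set.univ : Set ℝ) ×ˢ Set.Ioi (0 : ℝ)) := convex_univ.prod (convex_Ioi 0)
  refine convexOn_iInf_of_jointly_convex hs (fun u hu v hv x y a b ha hb hab => ?_)
    fun q hq => bddBelow_tiltedObjective hL w d q.1 γ β hq.2 hτ h
  have hlin : ∑ i, (β * d * h i - γ * w i) * ((a * x i + b * y i) - (a * u.1 + b * v.1) * w i)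
      = a * ∑ i, (β * d * h i - γ * w i) * (x i - u.1 * w i)
        + b * ∑ i, (β * d * h i - γ * w i) * (y i - v.1 * w i) := by
    rw [Finset.mul_sum, Finset.mul_sum, ← Finset.sum_add_distrib]
    exact Finset.sum_congr rfl fun i _ => by ring
  have hquad : ∑ i, ((a * x i + b * y i) - (a * u.1 + b * v.1) * w i) ^ 2
        / (a * u.2 + b * v.2)
      ≤ a * ∑ i, (x i - u.1 * w i) ^ 2 / u.2 + b * ∑ i, (y i - v.1 * w i) ^ 2 / v.2 := by
    rw [Finset.mul_sum, Finset.mul_sum, ← Finset.sum_add_distrib]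
    refine Finset.sum_le_sum fun i _ => ?_
    refine le_trans (le_of_eq ?_)
      (sq_div_combo_le ha hb hab hu.2 hv.2 (x i - u.1 * w i) (y i - v.1 * w i))
    congr 2
    ring
  have hconv := hψ.2 (Set.mem_univ x) (Set.mem_univ y) ha hb hab
  have hquad' := mul_le_mul_of_nonneg_left hquad (by positivity : 0 ≤ τ / 2)
  simp only [smul_eq_mul] at hconv
  simp only [tiltedObjective, Prod.fst_add, Prod.snd_add, Prod.smul_fst, Prod.smul_snd,
    Pi.add_apply, Pi.smul_apply, smul_eq_mul, hlin]
  linarith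

end TiltedEnvelope

theorem concaveOn_neg_quadratic_over_linear {δ σ : ℝ} (hδ : 0 ≤ δ) (hσ : 0 ≤ σ) (κ : ℝ) :
    ConcaveOn ℝ (Set.univ ×ˢ (Set.Ici (0 : ℝ)) ×ˢ (Set.Ioi (0 : ℝ)))
      (fun q : ℝ × ℝ × ℝ => -((σ / (2 * q.2.2)) * (δ * q.2.1 ^ 2 + q.1 ^ 2 * κ ^ 2))) := by
  refine ⟨convex_univ.prod ((convex_Ici 0).prod (convex_Ioi 0)),
    fun u hu v hv a b ha hb hab => ?_⟩
  have h1 := mul_le_mul_of_nonneg_left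
    (sq_div_combo_le ha hb hab hu.2.2 hv.2.2 u.2.1 v.2.1) (by positivity : 0 ≤ σ / 2 * δ)
  have h2 := mul_le_mul_of_nonneg_left
    (sq_div_combo_le ha hb hab hu.2.2 hv.2.2 u.1 v.1) (by positivity : 0 ≤ σ / 2 * κ ^ 2)
  have he : ∀ g β τ : ℝ, -((σ / (2 * τ)) * (δ * β ^ 2 + g ^ 2 * κ ^ 2))
      = -(σ / 2 * δ * (β ^ 2 / τ)) - σ / 2 * κ ^ 2 * (g ^ 2 / τ) := fun g β τ => by
    rw [mul_comm 2 τ, ← div_div]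
    ring
  simp only [he, Prod.fst_add, Prod.snd_add, Prod.smul_fst, Prod.smul_snd, smul_eq_mul]
  linarith

/-- In positive dimension, the quadratic penalty cancels against the Gaussian
average of the completed square. -/
theorem scalarObjective_eq_integral_tiltedEnv {p : ℕ} (hp : p ≠ 0) {wstar : Fin p → ℝ}
    {κ δ L : ℝ} (hw : Real.sqrt (∑ i, wstar i ^ 2) = κ * Real.sqrt p) (hδ : 0 < δ)
    {ψ : (Fin p → ℝ) → ℝ}
    (hL : ∀ u w : Fin p → ℝ, |ψ u - ψ w| ≤ L * Real.sqrt (∑ i, (u i - w i) ^ 2))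
    (ρ : ℝ → ℝ) (α γ' β : ℝ) {σ τ : ℝ} (hσ : 0 < σ) (hτ : 0 < τ) :
    scalarObjective p wstar κ δ ψ ρ α σ γ' β τ
      = (1 / (p : ℝ)) * ∫ h, tiltedEnv wstar ψ (Real.sqrt δ) α σ γ' β τ h
          ∂(Measure.pi fun _ : Fin p => gaussianReal 0 1)
        + β * Real.sqrt (summaryFunctional ρ κ α σ) - σ * τ / 2 := by
  have hw2 : ∑ i, wstar i ^ 2 = κ ^ 2 * p := by
    rw [← Real.sq_sqrt (Finset.sum_nonneg fun i _ => sq_nonneg (wstar i)), hw, mul_pow,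
      Real.sq_sqrt (Nat.cast_nonneg p)]
  have hp' : (p : ℝ) ≠ 0 := Nat.cast_ne_zero.2 hp
  rw [scalarObjective, integral_moreauEnv_eq hL wstar (Real.sqrt δ) α γ' β hσ hτ, hw2, mul_pow,
    Real.sq_sqrt hδ.le]
  field_simp
  ring

/-- The scalarized CGMT objective `C` is jointly convex in `(α, σ)` on `ℝ × (0,∞)` for
each fixed `(γ', β, τ)` with `β ≥ 0`, `τ > 0`, and jointly concave in `(γ', β, τ)` on
`ℝ × [0,∞) × (0,∞)` for each fixed `(α, σ)` with `σ > 0`. -/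
theorem scalarObjective_convex_concave (p : ℕ) (wstar : Fin p → ℝ)
    (κ : ℝ) (hκ : 0 ≤ κ) (hw : Real.sqrt (∑ i, wstar i ^ 2) = κ * Real.sqrt p)
    (δ : ℝ) (hδ : 0 < δ)
    (ψ : (Fin p → ℝ) → ℝ) (hψ : ConvexOn ℝ Set.univ ψ)
    (L : ℝ) (hL : ∀ u w : Fin p → ℝ,
      |ψ u - ψ w| ≤ L * Real.sqrt (∑ i, (u i - w i) ^ 2))
    (ρ : ℝ → ℝ) (hρmeas : Measurable ρ) (hρ : ∀ t, ρ t ∈ Set.Icc (0 : ℝ) 1) :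
    (∀ γ' β τ : ℝ, 0 ≤ β → 0 < τ →
      ConvexOn ℝ (Set.univ ×ˢ Set.Ioi (0 : ℝ))
        (fun q : ℝ × ℝ => scalarObjective p wstar κ δ ψ ρ q.1 q.2 γ' β τ)) ∧
    (∀ α σ : ℝ, 0 < σ →
      ConcaveOn ℝ (Set.univ ×ˢ (Set.Ici (0 : ℝ)) ×ˢ (Set.Ioi (0 : ℝ)))
        (fun q : ℝ × ℝ × ℝ =>
          scalarObjective p wstar κ δ ψ ρ α σ q.1 q.2.1 q.2.2)) := by
  have hs₁ : Convex ℝ ((Set.univ : Set ℝ) ×ˢ Set.Ioi (0 : ℝ)) := convex_univ.prod (convex_Ioi 0)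
  have hs₂ : Convex ℝ ((Set.univ : Set ℝ) ×ˢ (Set.Ici (0 : ℝ)) ×ˢ (Set.Ioi (0 : ℝ))) :=
    convex_univ.prod ((convex_Ici 0).prod (convex_Ioi 0))
  have hsqrt (β : ℝ) (hβ : 0 ≤ β) : ConvexOn ℝ ((Set.univ : Set ℝ) ×ˢ Set.Ioi (0 : ℝ))
      (fun q : ℝ × ℝ => β * Real.sqrt (summaryFunctional ρ κ q.1 q.2)) :=
    ((convexOn_sqrt_summaryFunctional hρmeas hρ κ).subset (Set.subset_univ _) hs₁).smul hβ
  have hlin₁ (c : ℝ) : ConvexOn ℝ ((Set.univ : Set ℝ) ×ˢ Set.Ioi (0 : ℝ))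
      (fun q : ℝ × ℝ => c * q.2) :=
    (c • LinearMap.snd ℝ ℝ ℝ).convexOn hs₁
  have hlin₂ (c e : ℝ) : ConcaveOn ℝ
      ((Set.univ : Set ℝ) ×ˢ (Set.Ici (0 : ℝ)) ×ˢ (Set.Ioi (0 : ℝ)))
      (fun q : ℝ × ℝ × ℝ => c * q.2.1 + e * q.2.2) :=
    ((c • LinearMap.fst ℝ ℝ ℝ + e • LinearMap.snd ℝ ℝ ℝ) ∘ₗ LinearMap.snd ℝ ℝ (ℝ × ℝ)).concaveOn
      hs₂
  rcases eq_or_ne p 0 with rfl | hp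
  · refine ⟨fun γ' β τ hβ _ => ?_, fun α σ hσ => ?_⟩
    · refine ((hsqrt β hβ).add
        (hlin₁ (-(τ / 2) - 1 / (2 * τ) * (δ * β ^ 2 + γ' ^ 2 * κ ^ 2)))).congr fun q _ => ?_
      simp only [scalarObjective, Pi.add_apply, Nat.cast_zero, div_zero, zero_mul]
      ring
    · refine ((hlin₂ (Real.sqrt (summaryFunctional ρ κ α σ)) (-(σ / 2))).add
        (concaveOn_neg_quadratic_over_linear hδ.le hσ.le κ)).congr fun q _ => ?_
      simp only [scalarObjective, Pi.add_apply, Nat.cast_zero, div_zero, zero_mul]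
      ring
  · have hp₀ : (0 : ℝ) ≤ 1 / p := by positivity
    refine ⟨fun γ' β τ hβ hτ => ?_, fun α σ hσ => ?_⟩
    · refine ((((integral_convexOn_of_integrand_ae hs₁ (Filter.Eventually.of_forall fun h =>
        convexOn_tiltedEnv hL wstar (Real.sqrt δ) hψ γ' β hτ h) fun q hq =>
        integrable_tiltedEnv hL wstar (Real.sqrt δ) q.1 γ' β hq.2 hτ).smul hp₀).add
        (hsqrt β hβ)).add (hlin₁ (-(τ / 2)))).congr fun q hq => ?_
      rw [scalarObjective_eq_integral_tiltedEnv hp hw hδ hL ρ q.1 γ' β hq.2 hτ]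
      simp only [Pi.add_apply, smul_eq_mul]
      ring
    · refine (((integral_concaveOn_of_integrand_ae hs₂ (Filter.Eventually.of_forall fun h =>
        concaveOn_tiltedEnv hL wstar (Real.sqrt δ) α hσ h) fun q hq =>
        integrable_tiltedEnv hL wstar (Real.sqrt δ) α q.1 q.2.1 hσ hq.2.2).smul hp₀).add
        (hlin₂ (Real.sqrt (summaryFunctional ρ κ α σ)) (-(σ / 2)))).congr fun q hq => ?_
      rw [scalarObjective_eq_integral_tiltedEnv hp hw hδ hL ρ α q.1 q.2.1 hσ hq.2.2]
      simp only [Pi.add_apply, smul_eq_mul]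
      ring
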